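/- Let (W,S) be a Coxeter system with distinct special subgroups A = W_{S_A} and B = W_{S_B}, and let ρ : A *_{A∩B} B → W be the natural homomorphism onto ⟨A, B⟩. If A ⊆ B or B ⊆ A, then ρ is injective. Otherwise, let m = min{ m_{a,b} : a ∈ S_A − S_B, b ∈ S_B − S_A }. If m = ∞ then ρ is injective; if m < ∞ then ker ρ is nontrivial and the minimal normal form length among nontrivial elements of ker ρ is exactly 2m. (Equivalently, the Gersten–Stallings angle ∠_W(A,B;A∩B) is 0 if A ⊆ B or B ⊆ A, and is π/m otherwise, where π/∞ = 0.) -/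

import Mathlib

open CoxeterSystem

namespace CoxFA

variable {B : Type*}

/-- The special subgroup of `W` generated by the simple reflections indexed by `T`. -/
def sp {W : Type*} [Group W] {M : CoxeterMatrix B} (cs : CoxeterSystem M W) (T : Set B) :
    Subgroup W :=
  Subgroup.closure (cs.simple '' T)

section Amalg

variable {H : Type*} [Group H]

/-- The two-element family of subgroups `A`, `B`. -/
abbrev fam2 (A B : Subgroup H) : Bool → Subgroup H := fun i => cond i A B

/-- The inclusions of `K` into `A` and `B`. -/
def phi2 (A B K : Subgroup H) (hA : K ≤ A) (hB : K ≤ B) :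
    (i : Bool) → (↥K →* ↥(fam2 A B i))
  | true => Subgroup.inclusion hA
  | false => Subgroup.inclusion hB

/-- The amalgamated free product `A *_K B`, i.e. the pushout of `A ← K → B`. -/
abbrev AmalgK (A B K : Subgroup H) (hA : K ≤ A) (hB : K ≤ B) : Type _ :=
  Monoid.PushoutI (phi2 A B K hA hB)

/-- The canonical map `A → A *_K B`. -/
def intoA (A B K : Subgroup H) (hA : K ≤ A) (hB : K ≤ B) :
    ↥A →* AmalgK A B K hA hB :=
  Monoid.PushoutI.of (φ := phi2 A B K hA hB) true

/-- The canonical map `B → A *_K B`. -/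
def intoB (A B K : Subgroup H) (hA : K ≤ A) (hB : K ≤ B) :
    ↥B →* AmalgK A B K hA hB :=
  Monoid.PushoutI.of (φ := phi2 A B K hA hB) false

/-- The natural homomorphism `A *_K B → H` induced by the inclusions of `A` and `B` in `H`. -/
noncomputable def rhoK (A B K : Subgroup H) (hA : K ≤ A) (hB : K ≤ B) :
    AmalgK A B K hA hB →* H :=
  Monoid.PushoutI.lift (fun i => (fam2 A B i).subtype) K.subtype (by
    intro i
    cases i <;> exact MonoidHom.ext fun x => rfl)

end Amalg

section NormalForm

variable {H : Type*} [Group H]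

/-- `AltList P Q l` says that the entries of `l` lie alternately in `P` and `Q`,
starting with `P`. -/
def AltList (P Q : Subgroup H) : List H → Prop
  | [] => True
  | x :: l => x ∈ P ∧ AltList Q P l

/-- The set of `k` such that `g` is a product of `k` factors lying alternately in `P` and `Q`. -/
def nfSet (P Q : Subgroup H) (g : H) : Set ℕ :=
  {k | ∃ l : List H, l.length = k ∧ l.prod = g ∧ (AltList P Q l ∨ AltList Q P l)}

/-- The normal form length of `g`: the minimal number of factors lying alternately in `P` and
`Q` needed to write `g`. -/
noncomputable def nfLength (P Q : Subgroup H) (g : H) : ℕ := sInf (nfSet P Q g)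

end NormalForm

section AmalgCox

variable {W : Type*} [Group W] {M : CoxeterMatrix B}

/-- The amalgamated free product `A *_{A ∩ B} B` of the special subgroups `A = W_{S_A}` and
`B = W_{S_B}`. -/
noncomputable abbrev Am (cs : CoxeterSystem M W) (SA SB : Set B) : Type _ :=
  AmalgK (sp cs SA) (sp cs SB) (sp cs SA ⊓ sp cs SB) inf_le_left inf_le_right

/-- The canonical map `W_{S_A} → A *_{A ∩ B} B`. -/
noncomputable def ofA (cs : CoxeterSystem M W) (SA SB : Set B) :
    ↥(sp cs SA) →* Am cs SA SB :=
  intoA _ _ _ inf_le_left inf_le_right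

/-- The canonical map `W_{S_B} → A *_{A ∩ B} B`. -/
noncomputable def ofB (cs : CoxeterSystem M W) (SA SB : Set B) :
    ↥(sp cs SB) →* Am cs SA SB :=
  intoB _ _ _ inf_le_left inf_le_right

/-- The natural homomorphism `ρ : A *_{A ∩ B} B → W`. -/
noncomputable def rhoAB (cs : CoxeterSystem M W) (SA SB : Set B) : Am cs SA SB →* W :=
  rhoK _ _ _ inf_le_left inf_le_right

end AmalgCox

section Geometric

open Real Polynomial.Chebyshev

/-- The simple coroot of index `i` in the geometric representation of a Coxeter group. -/
noncomputable def coroot (M : CoxeterMatrix B) (i : B) : Module.Dual ℝ (B →₀ ℝ) :=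
  Finsupp.lsum ℝ fun j => (-2 * cos (π / M i j)) • LinearMap.id

theorem coroot_single (M : CoxeterMatrix B) (i j : B) :
    coroot M i (Finsupp.single j 1) = -2 * cos (π / M i j) := by
  simp [coroot]

theorem coroot_self (M : CoxeterMatrix B) (i : B) :
    coroot M i (Finsupp.single i 1) = 2 := by
  simp [coroot_single]

/-- The reflection by which the simple generator `i` acts in the geometric representation. -/
noncomputable def geomReflection (M : CoxeterMatrix B) (i : B) : (B →₀ ℝ) ≃ₗ[ℝ] (B →₀ ℝ) :=
  Module.reflection (coroot_self M i)

theorem coroot_mul_coroot (M : CoxeterMatrix B) (i j : B) :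
    2 * cos (2 * π / M i j) =
      coroot M i (Finsupp.single j 1) * coroot M j (Finsupp.single i 1) - 2 := by
  rw [coroot_single, coroot_single, M.symmetric j i, mul_div_assoc, cos_two_mul]
  ring

theorem sin_two_pi_div_pos {m : ℕ} (hm : 3 ≤ m) : 0 < sin (2 * π / m) := by
  have hm' : (3 : ℝ) ≤ m := by exact_mod_cast hm
  apply sin_pos_of_pos_of_lt_pi (by positivity)
  rw [div_lt_iff₀ (by linarith)]
  nlinarith [pi_pos]

theorem isLiftable_geomReflection (M : CoxeterMatrix B) : M.IsLiftable (geomReflection M) := by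
  intro i j
  rcases Nat.lt_or_ge (M i j) 3 with h | h
  · interval_cases hm : M i j
    · exact pow_zero _
    · have : i = j := by
        by_contra hij
        exact M.off_diagonal i j hij hm
      subst this
      ext1 z
      simp only [pow_one, LinearEquiv.mul_apply]
      exact Module.involutive_reflection (coroot_self M i) z
    · have h1 : coroot M i (Finsupp.single j 1) = 0 := by rw [coroot_single, hm]; simp
      have h2 : coroot M j (Finsupp.single i 1) = 0 := by
        rw [coroot_single, M.symmetric, hm]; simp
      ext1 z
      simp only [pow_two, LinearEquiv.mul_apply, geomReflection, Module.reflection_apply, map_sub,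
        map_smul, coroot_self, h1, h2, LinearEquiv.coe_one, id]
      module
  · have hs := (sin_two_pi_div_pos h).ne'
    have hm0 : (M i j : ℝ) ≠ 0 := by positivity
    have key : ∀ n : ℤ, (S ℝ n).eval (2 * cos (2 * π / M i j)) * sin (2 * π / M i j) =
      sin ((n + 1) * (2 * π / M i j)) := fun n => S_two_mul_real_cos _ n
    ext1 z
    rw [geomReflection, geomReflection, Module.reflection_mul_reflection_pow_apply _ _ _ z _
      (coroot_mul_coroot M i j)]
    rcases Nat.even_or_odd' (M i j) with ⟨q, hq | hq⟩
    · have e1 : ((M i j : ℤ) - 2) / 2 = q - 1 := by omega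
      have e2 : ((M i j : ℤ) - 1) / 2 = q - 1 := by omega
      have hS : (S ℝ ((q : ℤ) - 1)).eval (2 * cos (2 * π / M i j)) = 0 := by
        have := key (q - 1)
        rw [show (((q : ℤ) - 1 : ℤ) + 1 : ℝ) * (2 * π / M i j) = π by
          have : (M i j : ℝ) = 2 * q := by exact_mod_cast hq
          rw [this] at hm0
          have hq0 : (q : ℝ) ≠ 0 := right_ne_zero_of_mul hm0
          push_cast; rw [this]; field_simp; ring, sin_pi] at this
        exact (mul_eq_zero.mp this).resolve_right hs
      rw [e1, e2, hS]
      simp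
    · have e1 : ((M i j : ℤ) - 2) / 2 = q - 1 := by omega
      have e2 : ((M i j : ℤ) - 1) / 2 = q := by omega
      have e3 : ((M i j : ℤ) - 3) / 2 = q - 1 := by omega
      have e4 : (M i j : ℤ) / 2 = q := by omega
      have hS : (S ℝ (q : ℤ)).eval (2 * cos (2 * π / M i j)) +
          (S ℝ ((q : ℤ) - 1)).eval (2 * cos (2 * π / M i j)) = 0 := by
        have h1 := key q
        have h2 := key (q - 1)
        have h3 : ((q : ℤ) + 1 : ℝ) * (2 * π / M i j) =
            2 * π - (((q : ℤ) - 1 : ℤ) + 1 : ℝ) * (2 * π / M i j) := by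
          have : (M i j : ℝ) = 2 * q + 1 := by exact_mod_cast hq
          push_cast; rw [this] at hm0 ⊢; field_simp; ring
        rw [h3, sin_two_pi_sub, ← h2] at h1
        exact (mul_eq_zero.mp (show (_ + _) * sin (2 * π / M i j) = 0 by
          rw [add_mul, h1]; ring)).resolve_right hs
      rw [e1, e2, e3, e4, hS]
      simp

theorem geomReflection_mul_pow_ne_one (M : CoxeterMatrix B) {i j : B} (hij : i ≠ j) {k : ℕ}
    (hk : k ≠ 0) (hkM : M i j = 0 ∨ k < M i j) :
    (geomReflection M i * geomReflection M j) ^ k ≠ 1 := by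
  classical
  intro h
  have h1 := Module.reflection_mul_reflection_pow_apply_self (coroot_self M i) (coroot_self M j)
    k _ (coroot_mul_coroot M i j)
  change ((geomReflection M i * geomReflection M j) ^ k) _ = _ at h1
  rw [h] at h1
  have hx := DFunLike.congr_fun h1 i
  have hy := DFunLike.congr_fun h1 j
  simp only [LinearEquiv.coe_one, id, Finsupp.add_apply, Finsupp.smul_apply,
    Finsupp.single_eq_same, Finsupp.single_eq_of_ne hij, Finsupp.single_eq_of_ne hij.symm,
    smul_eq_mul, mul_zero, mul_one, add_zero, zero_add, coroot_single] at hx hy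
  rcases Nat.lt_or_ge (M i j) 3 with h3 | h3
  · have hm1 := M.off_diagonal i j hij
    interval_cases hm : M i j
    · rw [M.symmetric] at hy
      simp [hm] at hy
      exact hk hy
    · exact hm1 rfl
    · obtain rfl : k = 1 := by omega
      simp [S_one, S_zero] at hx
  · have hkM : k < M i j := by omega
    have hs := sin_two_pi_div_pos h3
    have hm3 : (3 : ℝ) ≤ M i j := by exact_mod_cast h3
    have hm0 : (M i j : ℝ) ≠ 0 := by positivity
    have hc : cos (π / M i j) ≠ 0 := by
      refine (cos_pos_of_mem_Ioo ⟨by have := pi_pos; have : 0 < π / M i j := by positivity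
                                     linarith, ?_⟩).ne'
      rw [div_lt_iff₀ (by linarith)]
      nlinarith [pi_pos]
    have hS : (S ℝ ((k : ℤ) - 1)).eval (2 * cos (2 * π / M i j)) = 0 := by
      rw [M.symmetric j i] at hy
      have := hy.symm
      simpa [hc] using this
    rw [hS, add_zero] at hx
    have k1 := S_two_mul_real_cos (2 * π / M i j) (k - 1)
    have k2 := S_two_mul_real_cos (2 * π / M i j) k
    rw [hS, zero_mul] at k1
    rw [← hx, one_mul] at k2
    have hkpos : (0 : ℝ) < k := by exact_mod_cast Nat.pos_of_ne_zero hk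
    have hklt : (k : ℝ) < M i j := by exact_mod_cast hkM
    push_cast at k1 k2
    rw [sub_add_cancel] at k1
    rw [add_mul, one_mul, sin_add, ← k1, zero_mul, zero_add] at k2
    have hcos : cos (k * (2 * π / M i j)) = 1 :=
      mul_right_cancel₀ hs.ne' (by rw [one_mul]; exact k2.symm)
    have := (cos_eq_one_iff_of_lt_of_lt (x := k * (2 * π / M i j)) (by
      have := pi_pos
      have : 0 < k * (2 * π / M i j) := by positivity
      linarith) (by
      rw [← mul_div_assoc, div_lt_iff₀ (by linarith)]
      nlinarith [pi_pos])).mp hcos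
    have h5 : 0 < k * (2 * π / M i j) := by have := pi_pos; positivity
    exact h5.ne' this

end Geometric

section Coxeter

variable {W : Type*} [Group W] {M : CoxeterMatrix B} (cs : CoxeterSystem M W)

theorem simple_mul_simple_pow_ne_one {i j : B} (hij : i ≠ j) {k : ℕ}
    (hk : k ≠ 0) (hkM : M i j = 0 ∨ k < M i j) :
    (cs.simple i * cs.simple j) ^ k ≠ 1 := by
  intro h
  have := congrArg (cs.lift ⟨geomReflection M, isLiftable_geomReflection M⟩) h
  rw [map_pow, map_mul, cs.lift_apply_simple, cs.lift_apply_simple, map_one] at this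
  exact geomReflection_mul_pow_ne_one M hij hk hkM this

end Coxeter

section Exchange

variable {W : Type*} [Group W] {M : CoxeterMatrix B} (cs : CoxeterSystem M W)

theorem reverse_alternatingWord_two_mul (i j : B) (m : ℕ) :
    (alternatingWord i j (2 * m)).reverse = alternatingWord j i (2 * m) := by
  refine List.ext_getElem (by simp) fun k hk _ => ?_
  simp only [List.length_reverse, length_alternatingWord] at hk
  rw [List.getElem_reverse, getElem_alternatingWord _ _ _ _ (by simp; omega),
    getElem_alternatingWord _ _ _ _ hk]
  simp only [length_alternatingWord]
  by_cases h : Even k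
  · rw [if_neg (by grind), if_pos (by grind)]
  · rw [if_pos (by grind), if_neg (by grind)]

theorem prod_map_alternatingWord_two_mul {G : Type*} [Monoid G] (f : B → G) (i j : B) (m : ℕ) :
    ((alternatingWord i j (2 * m)).map f).prod = (f i * f j) ^ m := by
  induction m with
  | zero => simp [alternatingWord]
  | succ m ih =>
    rw [mul_add_one, alternatingWord_succ', alternatingWord_succ', if_neg (by grind),
      if_pos (by grind)]
    simp [ih, pow_succ', mul_assoc]

theorem even_count_rightInvSeq [DecidableEq W] (i j : B) (t : W) :
    Even ((cs.rightInvSeq (alternatingWord i j (2 * M i j))).count t) := by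
  rw [← reverse_alternatingWord_two_mul, cs.rightInvSeq_reverse, List.count_reverse]
  have hl : cs.leftInvSeq (alternatingWord j i (2 * M i j)) =
      (List.range (M i j + M i j)).map fun k => cs.simple j * (cs.simple i * cs.simple j) ^ k := by
    refine List.ext_getElem (by simp [two_mul]) fun k hk _ => ?_
    rw [cs.getElem_leftInvSeq_alternatingWord _ _ _ _ (by simpa using hk),
      cs.prod_alternatingWord_eq_mul_pow, if_neg (by grind)]
    simp [show (2 * k + 1) / 2 = k by omega]
  rw [hl, List.range_add, List.map_append, List.map_map]
  have : ((fun k => cs.simple j * (cs.simple i * cs.simple j) ^ k) ∘ fun x => M i j + x) =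
      fun k => cs.simple j * (cs.simple i * cs.simple j) ^ k := by
    ext k
    simp [pow_add]
  rw [this, List.count_append]
  exact Even.add_self _

open Classical in
/-- The action of a simple generator on `W × ZMod 2` by conjugation on the first component,
switching the second one at the generator itself. -/
noncomputable def inversionStep (i : B) : Function.End (W × ZMod 2) := fun p =>
  (cs.simple i * p.1 * cs.simple i, p.2 + if p.1 = cs.simple i then 1 else 0)

open Classical in
theorem prod_map_inversionStep (ω : List B) (t : W) (e : ZMod 2) :
    (ω.map (inversionStep cs)).prod (t, e) =
      (cs.wordProd ω * t * (cs.wordProd ω)⁻¹, e + (cs.rightInvSeq ω).count t) := by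
  induction ω with
  | nil =>
    simp
    rfl
  | cons i ω ih =>
    rw [List.map_cons, List.prod_cons]
    change inversionStep cs i ((ω.map (inversionStep cs)).prod (t, e)) = _
    rw [ih]
    simp only [inversionStep, rightInvSeq, List.count_cons, cs.wordProd_cons]
    refine Prod.ext (by simp [mul_assoc]) ?_
    have : (cs.wordProd ω * t * (cs.wordProd ω)⁻¹ = cs.simple i) ↔
        ((cs.wordProd ω)⁻¹ * cs.simple i * cs.wordProd ω = t) := by
      constructor
      · intro h
        rw [← h]
        group
      · intro h
        rw [← h]
        group
    simp only [this, beq_iff_eq]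
    push_cast
    ring

theorem isLiftable_inversionStep : M.IsLiftable (inversionStep cs) := by
  classical
  intro i j
  rw [← prod_map_alternatingWord_two_mul]
  funext ⟨t, e⟩
  rw [prod_map_inversionStep, (ZMod.natCast_eq_zero_iff_even).mpr (even_count_rightInvSeq cs i j t),
    CoxeterSystem.wordProd, prod_map_alternatingWord_two_mul, cs.simple_mul_simple_pow]
  simp
  rfl

theorem lift_inversionStep (ω : List B) :
    cs.lift ⟨_, isLiftable_inversionStep cs⟩ (cs.wordProd ω) =
      (ω.map (inversionStep cs)).prod := by
  rw [CoxeterSystem.wordProd, map_list_prod, List.map_map]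
  congr 2
  funext i
  exact cs.lift_apply_simple _ i

theorem simple_mem_rightInvSeq {ω : List B} {i : B}
    (h : cs.IsRightDescent (cs.wordProd ω) i) : cs.simple i ∈ cs.rightInvSeq ω := by
  classical
  by_contra hmem
  obtain ⟨u, hu, hwu⟩ := cs.exists_isReduced (cs.wordProd ω * cs.simple i)
  have hprod : cs.wordProd (u.concat i) = cs.wordProd ω := by
    rw [cs.wordProd_concat, ← hwu, cs.simple_mul_simple_cancel_right]
  have hred : cs.IsReduced (u.concat i) := by
    rw [CoxeterSystem.IsReduced, hprod, List.length_concat, ← hu.eq, ← hwu,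
      cs.isRightDescent_iff.mp h]
  have hcount : (cs.rightInvSeq (u.concat i)).count (cs.simple i) = 1 :=
    List.count_eq_one_of_mem hred.nodup_rightInvSeq (by rw [cs.rightInvSeq_concat]; simp)
  have h1 := congrFun (lift_inversionStep cs (u.concat i)) (cs.simple i, 0)
  rw [hprod, lift_inversionStep, prod_map_inversionStep, prod_map_inversionStep, hcount,
    List.count_eq_zero_of_not_mem hmem] at h1
  simpa using congrArg Prod.snd h1

/-- The exchange property of Coxeter groups. -/
theorem exists_eraseIdx_of_isLeftDescent {ω : List B} {i : B}
    (h : cs.IsLeftDescent (cs.wordProd ω) i) :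
    ∃ p < ω.length, cs.simple i * cs.wordProd ω = cs.wordProd (ω.eraseIdx p) := by
  have hmem : cs.simple i ∈ cs.leftInvSeq ω := by
    rw [← List.mem_reverse, ← cs.rightInvSeq_reverse]
    apply simple_mem_rightInvSeq
    rwa [cs.wordProd_reverse, cs.isRightDescent_inv_iff]
  obtain ⟨p, hp, hpi⟩ := List.getElem_of_mem hmem
  refine ⟨p, by simpa using hp, ?_⟩
  rw [← cs.getD_leftInvSeq_mul_wordProd, List.getD_eq_getElem _ _ hp, hpi]

end Exchange

section Matsumoto

variable {W : Type*} [Group W] {M : CoxeterMatrix B} (cs : CoxeterSystem M W)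

theorem eq_of_mem_rightInvSeq_alternatingWord {i j : B} {k : ℕ} {t : W}
    (ht : t ∈ cs.rightInvSeq (alternatingWord i j k)) :
    ∃ p < k, t = cs.simple j * (cs.simple i * cs.simple j) ^ p := by
  induction k generalizing i j t with
  | zero => simp [alternatingWord] at ht
  | succ k ih =>
    rw [alternatingWord_succ, cs.rightInvSeq_concat, List.concat_eq_append, List.mem_append,
      List.mem_map, List.mem_singleton] at ht
    rcases ht with ⟨u, hu, rfl⟩ | rfl
    · obtain ⟨p, hp, rfl⟩ := ih hu
      refine ⟨p + 1, by omega, ?_⟩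
      simp [pow_succ, ← mul_assoc, mul_pow_mul]
    · exact ⟨0, by omega, by simp⟩

theorem isReduced_alternatingWord {i j : B} (hij : i ≠ j) {k : ℕ} (hk : M i j = 0 ∨ k ≤ M i j) :
    cs.IsReduced (alternatingWord i j k) := by
  induction k generalizing i j with
  | zero => simp [CoxeterSystem.IsReduced, alternatingWord]
  | succ k ih =>
    have hred : cs.IsReduced (alternatingWord j i k) :=
      ih hij.symm (by rw [M.symmetric]; omega)
    rw [alternatingWord_succ, CoxeterSystem.IsReduced, cs.wordProd_concat, List.length_concat,
      ← hred.eq]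
    by_contra h
    obtain ⟨p, hp, hpi⟩ := eq_of_mem_rightInvSeq_alternatingWord cs
      (simple_mem_rightInvSeq cs (not_not.mp fun h' => h (cs.not_isRightDescent_iff.mp h')))
    refine simple_mul_simple_pow_ne_one cs hij.symm p.succ_ne_zero
      (by rw [M.symmetric]; omega) ?_
    rw [pow_succ', mul_assoc, ← hpi, cs.simple_mul_simple_self]

variable (M) in
/-- The relation between words obtained by applying one braid relation. -/
def BraidStep (ω ω' : List B) : Prop :=
  ∃ p i j q, i ≠ j ∧ M i j ≠ 0 ∧ ω = p ++ braidWord M i j ++ q ∧ ω' = p ++ braidWord M j i ++ q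

theorem BraidStep.symm {ω ω' : List B} : BraidStep M ω ω' → BraidStep M ω' ω := by
  rintro ⟨p, i, j, q, hij, hM, rfl, rfl⟩
  exact ⟨p, j, i, q, hij.symm, M.symmetric i j ▸ hM, rfl, rfl⟩

theorem BraidStep.cons (x : B) {ω ω' : List B} : BraidStep M ω ω' →
    BraidStep M (x :: ω) (x :: ω') := by
  rintro ⟨p, i, j, q, hij, hM, rfl, rfl⟩
  exact ⟨x :: p, i, j, q, hij, hM, by simp, by simp⟩

theorem BraidStep.wordProd_eq {ω ω' : List B} : BraidStep M ω ω' →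
    cs.wordProd ω = cs.wordProd ω' := by
  rintro ⟨p, i, j, q, -, -, rfl, rfl⟩
  simp only [cs.wordProd_append, cs.wordProd_braidWord_eq i j]

theorem BraidStep.length_eq {ω ω' : List B} : BraidStep M ω ω' → ω.length = ω'.length := by
  rintro ⟨p, i, j, q, -, -, rfl, rfl⟩
  simp [M.symmetric i j]

theorem exists_wordProd_alternatingWord_append {i j : B} (hij : i ≠ j) {w : W}
    (hi : cs.IsLeftDescent w i) (hj : cs.IsLeftDescent w j) {k : ℕ}
    (hk : M i j = 0 ∨ k ≤ M i j) :
    ∃ q, cs.wordProd (alternatingWord i j k ++ q) = w ∧ k + q.length = cs.length w := by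
  induction k with
  | zero =>
    obtain ⟨q, hq, hw⟩ := cs.exists_isReduced w
    exact ⟨q, by simp [alternatingWord, hw], by rw [hw, hq.eq, zero_add]⟩
  | succ k ih =>
    obtain ⟨q, hq, hl⟩ := ih (by omega)
    rw [alternatingWord_succ']
    set x := if Even k then j else i with hx
    have hxw : cs.IsLeftDescent w x := by rw [hx]; split_ifs <;> assumption
    obtain ⟨p, hp, he⟩ := exists_eraseIdx_of_isLeftDescent cs (hq.symm ▸ hxw)
    rw [List.length_append, length_alternatingWord] at hp
    rcases Nat.lt_or_ge p k with hpk | hpk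
    · exfalso
      rw [List.eraseIdx_append_of_lt_length (by simpa using hpk), cs.wordProd_append,
        cs.wordProd_append, ← mul_assoc, mul_left_inj, ← cs.wordProd_cons, hx,
        ← alternatingWord_succ'] at he
      have h1 := (isReduced_alternatingWord cs hij hk).eq
      have h2 := cs.length_wordProd_le ((alternatingWord i j k).eraseIdx p)
      rw [List.length_eraseIdx_of_lt (by simpa using hpk)] at h2
      rw [he, length_alternatingWord] at h1
      rw [length_alternatingWord] at h2
      omega
    · refine ⟨q.eraseIdx (p - k), ?_, ?_⟩
      · rw [List.eraseIdx_append_of_length_le (by simpa using hpk), length_alternatingWord] at he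
        rw [List.cons_append, cs.wordProd_cons, ← he, hq, cs.simple_mul_simple_cancel_left]
      · rw [List.length_eraseIdx_of_lt (by omega)]
        omega

theorem exists_braidStep_of_isLeftDescent {i j : B} (hij : i ≠ j) {w : W}
    (hi : cs.IsLeftDescent w i) (hj : cs.IsLeftDescent w j) :
    ∃ u v, BraidStep M (i :: u) (j :: v) ∧ cs.wordProd (i :: u) = w ∧
      (i :: u).length = cs.length w := by
  by_cases hM : M i j = 0
  · obtain ⟨q, -, hl⟩ := exists_wordProd_alternatingWord_append cs hij hi hj
      (k := cs.length w + 1) (Or.inl hM)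
    omega
  obtain ⟨q, hq, hl⟩ := exists_wordProd_alternatingWord_append cs hij hi hj (Or.inr le_rfl)
  have hstep : BraidStep M (braidWord M i j ++ q) (braidWord M j i ++ q) :=
    ⟨[], i, j, q, hij, hM, by simp, by simp⟩
  have hlen : (braidWord M i j ++ q).length = cs.length w := by simpa using hl
  change cs.wordProd (braidWord M i j ++ q) = w at hq
  obtain ⟨m, hm⟩ := Nat.exists_eq_succ_of_ne_zero hM
  have h1 : braidWord M i j = (if Even m then j else i) :: alternatingWord i j m := by
    rw [braidWord, hm, alternatingWord_succ']
  have h2 : braidWord M j i = (if Even m then i else j) :: alternatingWord j i m := by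
    rw [braidWord, M.symmetric, hm, alternatingWord_succ']
  by_cases he : Even m
  · rw [if_pos he] at h1 h2
    have hq' := (hstep.wordProd_eq cs).symm.trans hq
    have hlen' := hstep.length_eq.symm.trans hlen
    rw [h1, h2] at hstep
    rw [h2] at hq' hlen'
    exact ⟨_, _, hstep.symm, hq', hlen'⟩
  · rw [if_neg he] at h1 h2
    rw [h1, h2] at hstep
    rw [h1] at hq hlen
    exact ⟨_, _, hstep, hq, hlen⟩

theorem isLeftDescent_of_isReduced_cons {i : B} {u : List B} (h : cs.IsReduced (i :: u)) :
    cs.IsLeftDescent (cs.wordProd (i :: u)) i := by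
  have := cs.length_wordProd_le u
  rw [CoxeterSystem.IsLeftDescent, h.eq, cs.wordProd_cons, cs.simple_mul_simple_cancel_left,
    List.length_cons]
  omega

theorem isReduced_of_isReduced_cons {i : B} {u : List B} (h : cs.IsReduced (i :: u)) :
    cs.IsReduced u := by
  simpa using h.drop 1

open Relation in
/-- Matsumoto's theorem: two reduced words of the same element are related by a sequence of
braid relations. -/
theorem reflTransGen_braidStep {ω ω' : List B} (h : cs.IsReduced ω) (h' : cs.IsReduced ω')
    (heq : cs.wordProd ω = cs.wordProd ω') : ReflTransGen (BraidStep M) ω ω' := by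
  have hlen : ω.length = ω'.length := by rw [← h.eq, ← h'.eq, heq]
  induction hn : ω.length generalizing ω ω' with
  | zero =>
    obtain rfl := List.eq_nil_of_length_eq_zero hn
    obtain rfl := List.eq_nil_of_length_eq_zero hlen.symm
    rfl
  | succ n ih =>
    match ω, ω', hn, hlen ▸ hn with
    | i :: u, j :: v, hu, hv =>
    have hcons : ∀ {x : B} {a b : List B}, ReflTransGen (BraidStep M) a b →
        ReflTransGen (BraidStep M) (x :: a) (x :: b) :=
      fun {x} _ _ hab => hab.lift (x :: ·) fun _ _ => BraidStep.cons x
    have key : ∀ {x : B} {a b : List B}, cs.IsReduced (x :: a) → cs.IsReduced (x :: b) →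
        cs.wordProd (x :: a) = cs.wordProd (x :: b) → (x :: a).length = n + 1 →
        (x :: b).length = n + 1 → ReflTransGen (BraidStep M) (x :: a) (x :: b) := by
      intro x a b ha hb hab hla hlb
      rw [cs.wordProd_cons, cs.wordProd_cons, mul_right_inj] at hab
      simp only [List.length_cons, Nat.add_right_cancel_iff] at hla hlb
      exact hcons (ih (isReduced_of_isReduced_cons cs ha) (isReduced_of_isReduced_cons cs hb) hab
        (hla.trans hlb.symm) hla)
    by_cases hij : i = j
    · subst hij
      exact key h h' heq hu hv
    · obtain ⟨a, b, hab, hp, hl⟩ := exists_braidStep_of_isLeftDescent cs hij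
        (isLeftDescent_of_isReduced_cons cs h) (heq ▸ isLeftDescent_of_isReduced_cons cs h')
      have hla : (i :: a).length = n + 1 := by rw [hl, h.eq, hu]
      have hlb : (j :: b).length = n + 1 := by rw [← hab.length_eq, hla]
      have hpb := (hab.wordProd_eq cs).symm.trans hp
      have hra : cs.IsReduced (i :: a) := by rw [CoxeterSystem.IsReduced, hp, hl]
      have hrb : cs.IsReduced (j :: b) := by
        rw [CoxeterSystem.IsReduced, hpb, ← hab.length_eq, hl]
      exact ((key h hra hp.symm hu hla).tail hab).trans
        (key hrb h' (hpb.trans heq) hlb hv)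

variable (M) in
/-- The relation between words obtained by applying one braid relation or by deleting two equal
consecutive letters. -/
def TitsStep (ω ω' : List B) : Prop :=
  BraidStep M ω ω' ∨ ∃ p i q, ω = p ++ [i, i] ++ q ∧ ω' = p ++ q

theorem TitsStep.cons (x : B) {ω ω' : List B} : TitsStep M ω ω' →
    TitsStep M (x :: ω) (x :: ω') := by
  rintro (h | ⟨p, i, q, rfl, rfl⟩)
  · exact Or.inl (h.cons x)
  · exact Or.inr ⟨x :: p, i, q, by simp, by simp⟩

theorem TitsStep.wordProd_eq {ω ω' : List B} : TitsStep M ω ω' →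
    cs.wordProd ω = cs.wordProd ω' := by
  rintro (h | ⟨p, i, q, rfl, rfl⟩)
  · exact h.wordProd_eq cs
  · simp [cs.wordProd_append, cs.wordProd_cons]

open Relation in
/-- Tits' solution of the word problem: every word can be brought into reduced form by braid
relations and deletions. -/
theorem exists_isReduced_reflTransGen_titsStep (ω : List B) :
    ∃ ω', cs.IsReduced ω' ∧ cs.wordProd ω = cs.wordProd ω' ∧ ReflTransGen (TitsStep M) ω ω' := by
  induction ω with
  | nil => exact ⟨[], by simp [CoxeterSystem.IsReduced], rfl, .refl⟩
  | cons i u ih =>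
    obtain ⟨u', hu', hp, hs⟩ := ih
    have hs' : ReflTransGen (TitsStep M) (i :: u) (i :: u') :=
      hs.lift (i :: ·) fun _ _ => TitsStep.cons i
    have hp' : cs.wordProd (i :: u) = cs.wordProd (i :: u') := by
      rw [cs.wordProd_cons, hp, cs.wordProd_cons]
    by_cases hd : cs.IsLeftDescent (cs.wordProd u') i
    · obtain ⟨v, hv, hvp⟩ := cs.exists_isReduced (cs.simple i * cs.wordProd u')
      have hiv : cs.wordProd (i :: v) = cs.wordProd u' := by
        rw [cs.wordProd_cons, ← hvp, cs.simple_mul_simple_cancel_left]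
      have hivr : cs.IsReduced (i :: v) := by
        rw [CoxeterSystem.IsReduced, hiv, List.length_cons, ← hv.eq, ← hvp,
          cs.isLeftDescent_iff.mp hd]
      have hm := reflTransGen_braidStep cs hu' hivr hiv.symm
      refine ⟨v, hv, by rw [hp', cs.wordProd_cons, hvp], hs'.trans (.tail (b := i :: i :: v) ?_ ?_)⟩
      · exact hm.lift (i :: ·) fun _ _ h => TitsStep.cons i (Or.inl h)
      · exact Or.inr ⟨[], i, v, by simp, by simp⟩
    · refine ⟨i :: u', ?_, hp', hs'⟩
      rw [CoxeterSystem.IsReduced, cs.wordProd_cons, cs.not_isLeftDescent_iff.mp hd, hu'.eq,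
        List.length_cons]

end Matsumoto

section Switches

/-- The colour reached after reading `ω` from the colour `x`, where each letter `s` with
`lab s = some c` sets the colour to `c`. -/
def lastColour (lab : B → Option Bool) (x : Bool) (ω : List B) : Bool :=
  ω.foldl (fun y s => (lab s).getD y) x

/-- The number of colour changes made while reading `ω` from the colour `x`. -/
def switches (lab : B → Option Bool) : Bool → List B → ℕ
  | _, [] => 0
  | x, s :: ω => (if x = (lab s).getD x then 0 else 1) + switches lab ((lab s).getD x) ω

variable (lab : B → Option Bool)

theorem lastColour_cons (x : Bool) (s : B) (ω : List B) :
    lastColour lab x (s :: ω) = lastColour lab ((lab s).getD x) ω := rfl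

theorem lastColour_concat (x : Bool) (s : B) (ω : List B) :
    lastColour lab x (ω ++ [s]) = (lab s).getD (lastColour lab x ω) := by
  simp [lastColour]

theorem switches_append (x : Bool) (u v : List B) :
    switches lab x (u ++ v) = switches lab x u + switches lab (lastColour lab x u) v := by
  induction u generalizing x with
  | nil => simp [switches, lastColour]
  | cons s u ih => rw [List.cons_append, switches, switches, ih, lastColour_cons, add_assoc]

theorem switches_le (x y : Bool) (ω : List B) :
    switches lab x ω ≤ switches lab y ω + if x = y then 0 else 1 := by
  induction ω generalizing x y with
  | nil => simp [switches]
  | cons s ω ih =>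
    rw [switches, switches]
    rcases h : lab s with _ | c
    · simpa using ih x y
    · simp only [Option.getD_some]
      cases x <;> cases y <;> cases c <;> simp <;> omega

theorem lastColour_of_monochromatic {c : Bool} (x : Bool) {ω : List B}
    (h : ∀ s ∈ ω, lab s = none ∨ lab s = some c) :
    lastColour lab x ω = c ∨ lastColour lab x ω = x ∧ ∀ s ∈ ω, lab s = none := by
  induction ω generalizing x with
  | nil => simp [lastColour]
  | cons s ω ih =>
    simp only [List.forall_mem_cons] at h ⊢
    rw [lastColour_cons]
    rcases h.1 with hs | hs
    · simpa [hs] using ih x h.2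
    · left
      rcases ih ((lab s).getD x) h.2 with h' | ⟨h', -⟩
      · exact h'
      · rw [h', hs, Option.getD_some]

theorem lastColour_eq_of_mem {c : Bool} (x : Bool) {ω : List B}
    (h : ∀ s ∈ ω, lab s = none ∨ lab s = some c) {s : B} (hs : s ∈ ω) (hsc : lab s = some c) :
    lastColour lab x ω = c := by
  rcases lastColour_of_monochromatic lab x h with h' | ⟨-, h'⟩
  · exact h'
  · simp [h' s hs] at hsc

theorem lastColour_self {c : Bool} {ω : List B}
    (h : ∀ s ∈ ω, lab s = none ∨ lab s = some c) : lastColour lab c ω = c := by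
  rcases lastColour_of_monochromatic lab c h with h' | ⟨h', -⟩ <;> exact h'

theorem lastColour_of_forall_none (x : Bool) {ω : List B} (h : ∀ s ∈ ω, lab s = none) :
    lastColour lab x ω = x :=
  lastColour_self lab fun s hs => Or.inl (h s hs)

theorem switches_of_monochromatic {c : Bool} (x : Bool) {ω : List B}
    (h : ∀ s ∈ ω, lab s = none ∨ lab s = some c) :
    switches lab x ω = if x = lastColour lab x ω then 0 else 1 := by
  induction ω generalizing x with
  | nil => simp [switches, lastColour]
  | cons s ω ih =>
    simp only [List.forall_mem_cons] at h
    rw [switches, ih _ h.2, lastColour_cons]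
    rcases h.1 with hs | hs
    · simp [hs]
    · simp [hs, lastColour_self lab h.2]

theorem le_switches_alternatingWord {i j : B} {c : Bool} (hi : lab i = some c)
    (hj : lab j = some !c) (x : Bool) (k : ℕ) :
    k ≤ switches lab x (alternatingWord i j k) + 1 := by
  induction k generalizing i j c with
  | zero => omega
  | succ k ih =>
    rcases k with _ | k
    · omega
    · have h1 := ih hj (c := !c) (by simpa using hi)
      rw [alternatingWord_succ, List.concat_eq_append, switches_append]
      have h2 : lastColour lab x (alternatingWord j i (k + 1)) = c := by
        rw [alternatingWord_succ, List.concat_eq_append, lastColour_concat, hi, Option.getD_some]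
      have h3 : switches lab c [j] = 1 := by cases c <;> simp [switches, hj]
      rw [h2, h3]
      omega

theorem mem_braidWord {M : CoxeterMatrix B} {i j : B} (hij : i ≠ j) (hM : M i j ≠ 0) {s : B} :
    s ∈ braidWord M i j ↔ s = i ∨ s = j := by
  have hmem : ∀ (k : ℕ) (i j : B), s ∈ alternatingWord i j k → s = i ∨ s = j := by
    intro k
    induction k with
    | zero => simp [alternatingWord]
    | succ k ih =>
      intro i j h
      rw [alternatingWord_succ, List.concat_eq_append, List.mem_append, List.mem_singleton] at h
      exact h.elim (fun h => (ih j i h).symm) Or.inr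
  refine ⟨hmem _ i j, fun h => ?_⟩
  obtain ⟨k, hk⟩ : ∃ k, M i j = k + 2 := ⟨M i j - 2, by have := M.off_diagonal i j hij; omega⟩
  simp [braidWord, hk, alternatingWord_succ, h]

theorem TitsStep.subset {M : CoxeterMatrix B} {ω ω' : List B} (h : TitsStep M ω ω') :
    ω' ⊆ ω := by
  rcases h with ⟨p, i, j, q, hij, hM, rfl, rfl⟩ | ⟨p, i, q, rfl, rfl⟩
  · intro s
    simp only [List.mem_append, mem_braidWord hij hM,
      mem_braidWord hij.symm (M.symmetric i j ▸ hM), or_comm (a := s = i), imp_self]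
  · intro s
    simp only [List.mem_append]
    tauto

theorem subset_of_reflTransGen_titsStep {M : CoxeterMatrix B} {ω ω' : List B}
    (h : Relation.ReflTransGen (TitsStep M) ω ω') : ω' ⊆ ω := by
  induction h with
  | refl => exact List.Subset.refl _
  | tail _ h ih => exact List.Subset.trans h.subset ih

theorem switches_append_le_of_subset {c : Bool} {u u' : List B}
    (hu : ∀ s ∈ u, lab s = none ∨ lab s = some c) (hs : u' ⊆ u) (x : Bool) (q : List B) :
    switches lab x (u' ++ q) ≤ switches lab x (u ++ q) := by
  have hu' : ∀ s ∈ u', lab s = none ∨ lab s = some c := fun s h => hu s (hs h)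
  rw [switches_append, switches_append, switches_of_monochromatic lab x hu,
    switches_of_monochromatic lab x hu']
  by_cases hc : ∃ s ∈ u', lab s = some c
  · obtain ⟨s, h, hsc⟩ := hc
    rw [lastColour_eq_of_mem lab x hu' h hsc, lastColour_eq_of_mem lab x hu (hs h) hsc]
  · have hn : lastColour lab x u' = x := lastColour_of_forall_none lab x fun s h =>
      (hu' s h).resolve_right fun hsc => hc ⟨s, h, hsc⟩
    have := switches_le lab x (lastColour lab x u) q
    rw [hn, if_pos rfl]
    omega

variable {lab}

theorem TitsStep.exists_monochromatic {M : CoxeterMatrix B} {n : ℕ}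
    (hlab : ∀ i j c, lab i = some c → lab j = some !c → M i j = 0 ∨ n ≤ M i j) {x : Bool}
    {ω ω' : List B} (h : TitsStep M ω ω') (hω : switches lab x ω + 2 ≤ n) :
    ∃ c p u u' q, ω = p ++ (u ++ q) ∧ ω' = p ++ (u' ++ q) ∧ TitsStep M u u' ∧
      ∀ s ∈ u, lab s = none ∨ lab s = some c := by
  rcases h with ⟨p, i, j, q, hij, hM, rfl, rfl⟩ | ⟨p, i, q, rfl, rfl⟩
  · have hcross : ∀ c, lab i = some c → lab j = some !c → False := by
      intro c hi hj
      have h1 := le_switches_alternatingWord lab hi hj (lastColour lab x p) (M i j)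
      rw [switches_append, switches_append, braidWord] at hω
      have := (hlab i j c hi hj).resolve_left hM
      omega
    obtain ⟨c, hc⟩ : ∃ c, (lab i = none ∨ lab i = some c) ∧ (lab j = none ∨ lab j = some c) := by
      rcases hi : lab i with _ | c <;> rcases hj : lab j with _ | d
      · exact ⟨true, by simp⟩
      · exact ⟨d, by simp⟩
      · exact ⟨c, by simp⟩
      · have : d ≠ !c := fun hd => hcross c hi (hd ▸ hj)
        exact ⟨c, by simp, by cases c <;> cases d <;> simp_all⟩
    exact ⟨c, p, braidWord M i j, braidWord M j i, q, by simp, by simp,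
      Or.inl ⟨[], i, j, [], hij, hM, by simp, by simp⟩,
      by simpa [mem_braidWord hij hM] using hc⟩
  · obtain ⟨c, hc⟩ : ∃ c, lab i = none ∨ lab i = some c := by
      rcases hi : lab i with _ | c
      · exact ⟨true, by simp⟩
      · exact ⟨c, by simp⟩
    exact ⟨c, p, [i, i], [], q, by simp, by simp, Or.inr ⟨[], i, [], by simp, by simp⟩,
      by simpa using hc⟩

theorem switches_titsStep_le {M : CoxeterMatrix B} {n : ℕ}
    (hlab : ∀ i j c, lab i = some c → lab j = some !c → M i j = 0 ∨ n ≤ M i j) {x : Bool}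
    {ω ω' : List B} (h : TitsStep M ω ω') (hω : switches lab x ω + 2 ≤ n) :
    switches lab x ω' ≤ switches lab x ω := by
  obtain ⟨c, p, u, u', q, rfl, rfl, hs, hc⟩ := h.exists_monochromatic hlab hω
  rw [switches_append lab x p, switches_append lab x p]
  exact Nat.add_le_add_left (switches_append_le_of_subset lab hc hs.subset _ q) _

end Switches

section AltList

variable {H : Type*} [Group H]

theorem AltList.take {P Q : Subgroup H} {l : List H} (h : AltList P Q l) (k : ℕ) :
    AltList P Q (l.take k) := by
  induction k generalizing P Q l with
  | zero => trivial
  | succ k ih =>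
    cases l with
    | nil => trivial
    | cons x l => exact ⟨h.1, ih h.2⟩

theorem AltList.drop {P Q : Subgroup H} {l : List H} (h : AltList P Q l) (k : ℕ) :
    AltList P Q (l.drop k) ∨ AltList Q P (l.drop k) := by
  induction k generalizing P Q l with
  | zero => exact Or.inl h
  | succ k ih =>
    cases l with
    | nil => exact Or.inl trivial
    | cons x l => exact (ih h.2).symm

theorem AltList.append_singleton {P Q : Subgroup H} {l : List H} (h : AltList P Q l) {x : H}
    (hx : if Even l.length then x ∈ P else x ∈ Q) : AltList P Q (l ++ [x]) := by
  induction l generalizing P Q with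
  | nil => exact ⟨by simpa using hx, trivial⟩
  | cons y l ih =>
    refine ⟨h.1, ih h.2 ?_⟩
    simp only [List.length_cons, Nat.even_add_one] at hx
    split_ifs at hx ⊢ <;> simp_all

theorem AltList.reverse_inv {P Q : Subgroup H} {l : List H} (h : AltList P Q l) :
    if Even l.length then AltList Q P (l.map (·⁻¹)).reverse
      else AltList P Q (l.map (·⁻¹)).reverse := by
  induction l generalizing P Q with
  | nil => exact trivial
  | cons x l ih =>
    have hx := P.inv_mem h.1
    have h2 := ih h.2
    simp only [List.length_cons, Nat.even_add_one, List.map_cons, List.reverse_cons]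
    by_cases he : Even l.length
    · rw [if_pos he] at h2
      rw [if_neg (not_not.mpr he)]
      exact h2.append_singleton (by simpa [he] using hx)
    · rw [if_neg he] at h2
      rw [if_pos he]
      exact h2.append_singleton (by simpa [he] using hx)

theorem AltList.exists_prod_mul {P Q : Subgroup H} {l : List H} (h : AltList P Q l)
    (hl : l ≠ []) {x : H} (hx : if Even l.length then x ∈ Q else x ∈ P) :
    ∃ l', AltList P Q l' ∧ l'.length = l.length ∧ l'.prod = l.prod * x := by
  induction l generalizing P Q with
  | nil => exact absurd rfl hl
  | cons y l ih =>
    simp only [List.length_cons, Nat.even_add_one] at hx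
    cases l with
    | nil => exact ⟨[y * x], ⟨P.mul_mem h.1 (by simpa using hx), trivial⟩, rfl, by simp⟩
    | cons z l =>
      obtain ⟨l', h', hlen, hp⟩ := ih h.2 (by simp) (by split_ifs at hx ⊢ <;> simp_all)
      exact ⟨y :: l', ⟨h.1, h'⟩, by simp [hlen], by simp [hp, mul_assoc]⟩

theorem exists_altList_pow {P Q : Subgroup H} {x y : H} (hx : x ∈ P) (hy : y ∈ Q) (k : ℕ) :
    ∃ l, AltList P Q l ∧ l.length = 2 * k ∧ l.prod = (x * y) ^ k := by
  induction k with
  | zero => exact ⟨[], trivial, rfl, by simp⟩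
  | succ k ih =>
    obtain ⟨l, hl, hlen, hp⟩ := ih
    exact ⟨x :: y :: l, ⟨hx, hy, hl⟩, by simp [hlen]; ring, by simp [hp, pow_succ', mul_assoc]⟩

theorem nfSet_nonempty_mul {P Q : Subgroup H} {x g : H} (hx : x ∈ P ∨ x ∈ Q)
    (hg : (nfSet P Q g).Nonempty) : (nfSet P Q (x * g)).Nonempty := by
  have key : ∀ {P Q : Subgroup H} {l : List H}, x ∈ P ∨ x ∈ Q → AltList P Q l →
      ∃ l', l'.prod = x * l.prod ∧ (AltList P Q l' ∨ AltList Q P l') := by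
    intro P Q l hx hl
    rcases hx with hx | hx
    · cases l with
      | nil => exact ⟨[x], by simp, Or.inl ⟨hx, trivial⟩⟩
      | cons y l => exact ⟨(x * y) :: l, by simp [mul_assoc], Or.inl ⟨P.mul_mem hx hl.1, hl.2⟩⟩
    · exact ⟨x :: l, by simp, Or.inr ⟨hx, hl⟩⟩
  obtain ⟨_, l, -, rfl, hl | hl⟩ := hg
  · obtain ⟨l', hp, hl'⟩ := key hx hl
    exact ⟨_, l', rfl, hp, hl'⟩
  · obtain ⟨l', hp, hl'⟩ := key hx.symm hl
    exact ⟨_, l', rfl, hp, hl'.symm⟩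

end AltList

section Letters

variable {W : Type*} [Group W] {M : CoxeterMatrix B} (cs : CoxeterSystem M W)

theorem simple_mem_sp {T : Set B} {s : B} (hs : s ∈ T) : cs.simple s ∈ sp cs T :=
  Subgroup.subset_closure (Set.mem_image_of_mem _ hs)

theorem wordProd_mem_sp {T : Set B} {ω : List B} (hω : ∀ s ∈ ω, s ∈ T) :
    cs.wordProd ω ∈ sp cs T :=
  Subgroup.list_prod_mem _ (by
    simp only [List.mem_map, forall_exists_index, and_imp]
    rintro _ s hs rfl
    exact simple_mem_sp cs (hω s hs))

theorem exists_wordProd_of_mem_sp {T : Set B} {w : W} (hw : w ∈ sp cs T) :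
    ∃ ω, (∀ s ∈ ω, s ∈ T) ∧ cs.wordProd ω = w := by
  induction hw using Subgroup.closure_induction with
  | mem x hx =>
    obtain ⟨s, hs, rfl⟩ := hx
    exact ⟨[s], by simpa using hs, by simp⟩
  | one => exact ⟨[], by simp, by simp⟩
  | mul x y _ _ hx hy =>
    obtain ⟨u, hu, rfl⟩ := hx
    obtain ⟨v, hv, rfl⟩ := hy
    exact ⟨u ++ v, by simpa [or_imp, forall_and] using ⟨hu, hv⟩, cs.wordProd_append u v⟩
  | inv x _ hx =>
    obtain ⟨u, hu, rfl⟩ := hx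
    exact ⟨u.reverse, by simpa using hu, cs.wordProd_reverse u⟩

open Relation in
theorem exists_common_reflTransGen_titsStep {ω ω' : List B}
    (h : cs.wordProd ω = cs.wordProd ω') :
    ∃ u, ReflTransGen (TitsStep M) ω u ∧ ReflTransGen (TitsStep M) ω' u := by
  obtain ⟨u, hu, hp, hs⟩ := exists_isReduced_reflTransGen_titsStep cs ω
  obtain ⟨u', hu', hp', hs'⟩ := exists_isReduced_reflTransGen_titsStep cs ω'
  refine ⟨u', hs.trans ?_, hs'⟩
  exact ReflTransGen.mono (fun _ _ => Or.inl) _ _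
    (reflTransGen_braidStep cs hu hu' (by rw [← hp, h, hp']))

theorem simple_mem_sp_iff {T : Set B} {s : B} : cs.simple s ∈ sp cs T ↔ s ∈ T := by
  refine ⟨fun h => ?_, simple_mem_sp cs⟩
  obtain ⟨ω, hω, hp⟩ := exists_wordProd_of_mem_sp cs h
  obtain ⟨u, hu, hpu, hs⟩ := exists_isReduced_reflTransGen_titsStep cs ω
  have hred : cs.IsReduced [s] := by simp [CoxeterSystem.IsReduced]
  have hb : Relation.ReflTransGen (TitsStep M) u [s] :=
    Relation.ReflTransGen.mono (fun _ _ => Or.inl) _ _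
      (reflTransGen_braidStep cs hu hred (by rw [← hpu, hp, cs.wordProd_singleton]))
  exact hω s (subset_of_reflTransGen_titsStep (hs.trans hb) (by simp))

end Letters

section Factors

variable {W : Type*} [Group W] {M : CoxeterMatrix B} (cs : CoxeterSystem M W) (SA SB : Set B)

/-- The two canonical maps into the amalgamated product, indexed by colours. -/
noncomputable def factorHom : (c : Bool) → ↥(sp cs (cond c SA SB)) →* Am cs SA SB
  | true => ofA cs SA SB
  | false => ofB cs SA SB

theorem rhoAB_ofA (x : sp cs SA) : rhoAB cs SA SB (ofA cs SA SB x) = x := by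
  unfold rhoAB rhoK ofA intoA
  apply Monoid.PushoutI.lift_of

theorem rhoAB_ofB (x : sp cs SB) : rhoAB cs SA SB (ofB cs SA SB x) = x := by
  unfold rhoAB rhoK ofB intoB
  apply Monoid.PushoutI.lift_of

theorem rhoAB_factorHom (c : Bool) (x : sp cs (cond c SA SB)) :
    rhoAB cs SA SB (factorHom cs SA SB c x) = x := by
  cases c
  · exact rhoAB_ofB cs SA SB x
  · exact rhoAB_ofA cs SA SB x

theorem ofA_eq_ofB {w : W} (hA : w ∈ sp cs SA) (hB : w ∈ sp cs SB) :
    ofA cs SA SB ⟨w, hA⟩ = ofB cs SA SB ⟨w, hB⟩ :=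
  (Monoid.PushoutI.of_apply_eq_base
    (phi2 (sp cs SA) (sp cs SB) (sp cs SA ⊓ sp cs SB) inf_le_left inf_le_right) true
      ⟨w, hA, hB⟩).trans
    (Monoid.PushoutI.of_apply_eq_base
      (phi2 (sp cs SA) (sp cs SB) (sp cs SA ⊓ sp cs SB) inf_le_left inf_le_right) false
        ⟨w, hA, hB⟩).symm

/-- Induction on the elements of the amalgamated product by left multiplication by elements of
the factors. -/
theorem amalgam_induction {p : Am cs SA SB → Prop} (one : p 1)
    (mulA : ∀ x g, p g → p (ofA cs SA SB x * g)) (mulB : ∀ x g, p g → p (ofB cs SA SB x * g))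
    (g : Am cs SA SB) : p g := by
  have of_mul : ∀ i x h, p h → p (Monoid.PushoutI.of i x * h) := by
    rintro (_ | _) x h hh
    · exact mulB x h hh
    · exact mulA x h hh
  suffices ∀ h, p h → p (g * h) by simpa using this 1 one
  induction g using Monoid.PushoutI.induction_on with
  | of i x => exact of_mul i x
  | base k =>
    intro h hh
    rw [← Monoid.PushoutI.of_apply_eq_base _ true]
    exact of_mul _ _ h hh
  | mul x y hx hy =>
    intro h hh
    rw [mul_assoc]
    exact hx _ (hy _ hh)

theorem nfSet_nonempty (g : Am cs SA SB) :
    (nfSet (ofA cs SA SB).range (ofB cs SA SB).range g).Nonempty := by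
  refine amalgam_induction cs SA SB
    (p := fun g => (nfSet (ofA cs SA SB).range (ofB cs SA SB).range g).Nonempty)
    ⟨0, [], rfl, rfl, Or.inl trivial⟩ ?_ ?_ g
  · exact fun x g hg => nfSet_nonempty_mul (Or.inl ⟨x, rfl⟩) hg
  · exact fun x g hg => nfSet_nonempty_mul (Or.inr ⟨x, rfl⟩) hg

theorem rhoAB_injective_of_le (h : sp cs SA ≤ sp cs SB) :
    Function.Injective (rhoAB cs SA SB) := by
  have hr : ∀ g, g ∈ (ofB cs SA SB).range := by
    refine amalgam_induction cs SA SB (one_mem _) ?_ ?_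
    · rintro ⟨x, hx⟩ g hg
      rw [ofA_eq_ofB cs SA SB hx (h hx)]
      exact mul_mem ⟨_, rfl⟩ hg
    · exact fun x g hg => mul_mem ⟨x, rfl⟩ hg
  rw [injective_iff_map_eq_one]
  intro g hg
  obtain ⟨x, rfl⟩ := hr g
  rw [rhoAB_ofB] at hg
  rw [show x = 1 from Subtype.ext hg, map_one]

theorem rhoAB_injective_of_ge (h : sp cs SB ≤ sp cs SA) :
    Function.Injective (rhoAB cs SA SB) := by
  have hr : ∀ g, g ∈ (ofA cs SA SB).range := by
    refine amalgam_induction cs SA SB (one_mem _) ?_ ?_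
    · exact fun x g hg => mul_mem ⟨x, rfl⟩ hg
    · rintro ⟨x, hx⟩ g hg
      rw [← ofA_eq_ofB cs SA SB (h hx) hx]
      exact mul_mem ⟨_, rfl⟩ hg
  rw [injective_iff_map_eq_one]
  intro g hg
  obtain ⟨x, rfl⟩ := hr g
  rw [rhoAB_ofA] at hg
  rw [show x = 1 from Subtype.ext hg, map_one]

open Classical in
/-- The element of the amalgamated product represented by a letter of `SA ∪ SB`. -/
noncomputable def letter (s : B) : Am cs SA SB :=
  if h : s ∈ SA then ofA cs SA SB ⟨cs.simple s, simple_mem_sp cs h⟩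
  else if h : s ∈ SB then ofB cs SA SB ⟨cs.simple s, simple_mem_sp cs h⟩
  else 1

theorem letter_eq_factorHom (c : Bool) {s : B} (hs : s ∈ cond c SA SB) :
    letter cs SA SB s = factorHom cs SA SB c ⟨cs.simple s, simple_mem_sp cs hs⟩ := by
  cases c
  · by_cases h : s ∈ SA
    · rw [letter, dif_pos h]
      exact ofA_eq_ofB cs SA SB _ _
    · rw [letter, dif_neg h, dif_pos (show s ∈ SB from hs)]
      rfl
  · rw [letter, dif_pos (show s ∈ SA from hs)]
    rfl

theorem prod_map_letter (c : Bool) {ω : List B} (hω : ∀ s ∈ ω, s ∈ cond c SA SB) :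
    (ω.map (letter cs SA SB)).prod =
      factorHom cs SA SB c ⟨cs.wordProd ω, wordProd_mem_sp cs hω⟩ := by
  induction ω with
  | nil =>
    rw [List.map_nil, List.prod_nil, ← map_one (factorHom cs SA SB c)]
    exact congrArg _ (Subtype.ext (by simp))
  | cons s ω ih =>
    have h := List.forall_mem_cons.mp hω
    rw [List.map_cons, List.prod_cons, letter_eq_factorHom cs SA SB c h.1, ih h.2, ← map_mul]
    exact congrArg _ (Subtype.ext (cs.wordProd_cons s ω).symm)

theorem rhoAB_prod_map_letter {ω : List B} (hω : ∀ s ∈ ω, s ∈ SA ∪ SB) :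
    rhoAB cs SA SB (ω.map (letter cs SA SB)).prod = cs.wordProd ω := by
  induction ω with
  | nil => simp
  | cons s ω ih =>
    have h := List.forall_mem_cons.mp hω
    rw [List.map_cons, List.prod_cons, map_mul, ih h.2, cs.wordProd_cons]
    rcases h.1 with hs | hs
    · rw [letter_eq_factorHom cs SA SB true hs, rhoAB_factorHom]
    · rw [letter_eq_factorHom cs SA SB false hs, rhoAB_factorHom]

open Classical in
/-- The colour of a letter: `true` on `SA \ SB`, `false` on `SB \ SA`, and none otherwise. -/
noncomputable def colour (s : B) : Option Bool :=
  if s ∈ SA then if s ∈ SB then none else some true else if s ∈ SB then some false else none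

variable {SA SB}

theorem colour_of_mem {c : Bool} {s : B} (hs : s ∈ cond c SA SB) :
    colour SA SB s = none ∨ colour SA SB s = some c := by
  cases c <;> simp only [cond_true, cond_false] at hs <;> simp only [colour, hs, if_true] <;>
    split_ifs <;> simp

theorem mem_of_colour {c : Bool} {s : B} (hs : s ∈ SA ∪ SB)
    (hc : colour SA SB s = none ∨ colour SA SB s = some c) : s ∈ cond c SA SB := by
  by_cases h1 : s ∈ SA <;> by_cases h2 : s ∈ SB <;> cases c <;> simp_all [colour]

theorem mem_diff_of_colour {c : Bool} {s : B} (hc : colour SA SB s = some c) :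
    s ∈ cond c SA SB \ cond c SB SA := by
  by_cases h1 : s ∈ SA <;> by_cases h2 : s ∈ SB <;> cases c <;> simp_all [colour]

theorem colour_separated {n : ℕ} (H : ∀ a ∈ SA \ SB, ∀ b ∈ SB \ SA, M a b = 0 ∨ n ≤ M a b)
    (i j : B) (c : Bool) (hi : colour SA SB i = some c) (hj : colour SA SB j = some !c) :
    M i j = 0 ∨ n ≤ M i j := by
  have hi := mem_diff_of_colour hi
  have hj := mem_diff_of_colour hj
  cases c
  · rw [M.symmetric]
    exact H j hj i hi
  · exact H i hi j hj

theorem prod_map_letter_reflTransGen {n : ℕ}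
    (H : ∀ a ∈ SA \ SB, ∀ b ∈ SB \ SA, M a b = 0 ∨ n ≤ M a b) {x : Bool} {ω ω' : List B}
    (h : Relation.ReflTransGen (TitsStep M) ω ω') (hω : ∀ s ∈ ω, s ∈ SA ∪ SB)
    (hx : switches (colour SA SB) x ω + 2 ≤ n) :
    (ω.map (letter cs SA SB)).prod = (ω'.map (letter cs SA SB)).prod ∧
      switches (colour SA SB) x ω' + 2 ≤ n := by
  induction h with
  | refl => exact ⟨rfl, hx⟩
  | @tail v v' h hs ih =>
    have hle := switches_titsStep_le (colour_separated H) hs ih.2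
    refine ⟨ih.1.trans ?_, by omega⟩
    have hv : ∀ s ∈ v, s ∈ SA ∪ SB := fun s h' => hω s (subset_of_reflTransGen_titsStep h h')
    obtain ⟨c, p, u, u', q, rfl, rfl, hu, hc⟩ := hs.exists_monochromatic (colour_separated H) ih.2
    have h1 : ∀ s ∈ u, s ∈ cond c SA SB := fun s h' =>
      mem_of_colour (hv s (by simp [h'])) (hc s h')
    have h2 : ∀ s ∈ u', s ∈ cond c SA SB := fun s h' => h1 s (hu.subset h')
    simp only [List.map_append, List.prod_append, prod_map_letter cs SA SB c h1,
      prod_map_letter cs SA SB c h2, hu.wordProd_eq cs]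

theorem prod_map_letter_eq {n : ℕ}
    (H : ∀ a ∈ SA \ SB, ∀ b ∈ SB \ SA, M a b = 0 ∨ n ≤ M a b) {x x' : Bool} {ω ω' : List B}
    (h : cs.wordProd ω = cs.wordProd ω') (hω : ∀ s ∈ ω, s ∈ SA ∪ SB) (hω' : ∀ s ∈ ω', s ∈ SA ∪ SB)
    (hx : switches (colour SA SB) x ω + 2 ≤ n) (hx' : switches (colour SA SB) x' ω' + 2 ≤ n) :
    (ω.map (letter cs SA SB)).prod = (ω'.map (letter cs SA SB)).prod := by
  obtain ⟨u, hu, hu'⟩ := exists_common_reflTransGen_titsStep cs h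
  rw [(prod_map_letter_reflTransGen cs H hu hω hx).1,
    (prod_map_letter_reflTransGen cs H hu' hω' hx').1]

theorem exists_word_of_altList {c : Bool} {l : List (Am cs SA SB)}
    (h : AltList (factorHom cs SA SB c).range (factorHom cs SA SB !c).range l) :
    ∃ ω : List B, (∀ s ∈ ω, s ∈ SA ∪ SB) ∧ (ω.map (letter cs SA SB)).prod = l.prod ∧
      switches (colour SA SB) c ω ≤ l.length - 1 := by
  induction l generalizing c with
  | nil => exact ⟨[], by simp, by simp, by simp [switches]⟩
  | cons x l ih =>
    obtain ⟨⟨⟨w, hw⟩, rfl⟩, h2⟩ := h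
    obtain ⟨u, hu, rfl⟩ := exists_wordProd_of_mem_sp cs hw
    have hcol : ∀ s ∈ u, colour SA SB s = none ∨ colour SA SB s = some c := fun s hs =>
      colour_of_mem (hu s hs)
    have hu' : ∀ s ∈ u, s ∈ SA ∪ SB := fun s hs => by
      have := hu s hs
      cases c
      · exact Or.inr this
      · exact Or.inl this
    have hsw : switches (colour SA SB) c u = 0 := by
      rw [switches_of_monochromatic _ c hcol, lastColour_self _ hcol, if_pos rfl]
    have hp := prod_map_letter cs SA SB c hu
    cases l with
    | nil => exact ⟨u, hu', by simp [hp], by simp [hsw]⟩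
    | cons y l =>
      obtain ⟨v, hv, hvp, hvs⟩ := ih (c := !c) (by rwa [Bool.not_not])
      refine ⟨u ++ v, ?_, ?_, ?_⟩
      · intro s hs
        exact (List.mem_append.mp hs).elim (hu' s) (hv s)
      · rw [List.map_append, List.prod_append, hp, hvp]
        exact List.prod_cons.symm
      · have := switches_le (colour SA SB) c (!c) v
        rw [switches_append, hsw, lastColour_self _ hcol]
        simp only [List.length_cons] at hvs ⊢
        split_ifs at this <;> omega

theorem exists_word_of_mem_nfSet {k : ℕ} {g : Am cs SA SB}
    (hg : k ∈ nfSet (ofA cs SA SB).range (ofB cs SA SB).range g) :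
    ∃ x, ∃ ω : List B, (∀ s ∈ ω, s ∈ SA ∪ SB) ∧ (ω.map (letter cs SA SB)).prod = g ∧
      switches (colour SA SB) x ω ≤ k - 1 := by
  obtain ⟨l, rfl, rfl, hl | hl⟩ := hg
  · exact ⟨true, exists_word_of_altList cs (c := true) hl⟩
  · exact ⟨false, exists_word_of_altList cs (c := false) hl⟩

end Factors

section NormalForms

variable {H : Type*} [Group H] {P Q : Subgroup H} {g : H} {k : ℕ}

theorem exists_mul_of_mem_nfSet (h : k ∈ nfSet P Q g) {i : ℕ} (hi : i ≤ k) :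
    ∃ g₁ g₂, g = g₁ * g₂ ∧ i ∈ nfSet P Q g₁ ∧ k - i ∈ nfSet P Q g₂ := by
  obtain ⟨l, rfl, rfl, hl⟩ := h
  exact ⟨(l.take i).prod, (l.drop i).prod, (List.prod_take_mul_prod_drop l i).symm,
    ⟨_, by simpa using hi, rfl, hl.imp (·.take i) (·.take i)⟩,
    ⟨_, by simp, rfl, hl.elim (·.drop i) fun h => (h.drop i).symm⟩⟩

theorem inv_mem_nfSet (h : k ∈ nfSet P Q g) : k ∈ nfSet P Q g⁻¹ := by
  obtain ⟨l, rfl, rfl, hl⟩ := h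
  refine ⟨(l.map (·⁻¹)).reverse, by simp, (List.prod_inv_reverse l).symm, ?_⟩
  rcases hl with hl | hl <;> have := hl.reverse_inv <;> split_ifs at this <;> simp [this]

theorem exists_conj_mem_nfSet (hk : Odd k) (h1 : 1 < k) (h : k ∈ nfSet P Q g) :
    ∃ x, k - 1 ∈ nfSet P Q (x⁻¹ * g * x) := by
  have key : ∀ {P Q : Subgroup H} {l : List H}, AltList P Q l → Odd l.length → 1 < l.length →
      ∃ x l', AltList Q P l' ∧ l'.length = l.length - 1 ∧ l'.prod = x⁻¹ * l.prod * x := by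
    intro P Q l hl ho h1
    cases l with
    | nil => simp at h1
    | cons x l =>
      have he : Even l.length := by simpa [Nat.odd_add_one] using ho
      obtain ⟨l', hl', hlen, hp⟩ := hl.2.exists_prod_mul (x := x)
        (by rintro rfl; simp at h1) (by rw [if_pos he]; exact hl.1)
      exact ⟨x, l', hl', by simp [hlen], by simp [hp]⟩
  obtain ⟨l, rfl, rfl, hl | hl⟩ := h
  · obtain ⟨x, l', h1, h2, h3⟩ := key hl hk h1
    exact ⟨x, l', h2, h3, Or.inr h1⟩
  · obtain ⟨x, l', h1, h2, h3⟩ := key hl hk h1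
    exact ⟨x, l', h2, h3, Or.inl h1⟩

end NormalForms

section Kernel

variable {W : Type*} [Group W] {M : CoxeterMatrix B} (cs : CoxeterSystem M W) {SA SB : Set B}

/-- An element of the kernel of `rhoAB` of normal form length less than `2 * n` is trivial, where
`n` is a lower bound for the labels between `SA \ SB` and `SB \ SA`. -/
theorem eq_one_of_mem_nfSet {n : ℕ} (hn : 2 ≤ n)
    (H : ∀ a ∈ SA \ SB, ∀ b ∈ SB \ SA, M a b = 0 ∨ n ≤ M a b) {g : Am cs SA SB} {k : ℕ}
    (hg : rhoAB cs SA SB g = 1) (hk : k ∈ nfSet (ofA cs SA SB).range (ofB cs SA SB).range g)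
    (hkn : k < 2 * n) : g = 1 := by
  have short : ∀ {g : Am cs SA SB} {k : ℕ}, rhoAB cs SA SB g = 1 →
      k ∈ nfSet (ofA cs SA SB).range (ofB cs SA SB).range g → k ≤ 2 * n - 2 → g = 1 := by
    intro g k hg hk hkn
    obtain ⟨g₁, g₂, rfl, h₁, h₂⟩ := exists_mul_of_mem_nfSet hk (min_le_left k (n - 1))
    obtain ⟨x, ω, hω, rfl, hx⟩ := exists_word_of_mem_nfSet cs h₁
    obtain ⟨x', ω', hω', hp, hx'⟩ := exists_word_of_mem_nfSet cs (inv_mem_nfSet h₂)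
    rw [map_mul, mul_eq_one_iff_eq_inv, ← map_inv, ← hp, rhoAB_prod_map_letter cs SA SB hω,
      rhoAB_prod_map_letter cs SA SB hω'] at hg
    rw [mul_eq_one_iff_eq_inv, ← hp]
    exact prod_map_letter_eq cs H (x := x) (x' := x') hg hω hω' (by omega) (by omega)
  rcases Nat.lt_or_ge (2 * n - 2) k with h | h
  · obtain ⟨x, hx⟩ := exists_conj_mem_nfSet (by rw [Nat.odd_iff]; omega) (by omega) hk
    have := short (by simp [hg]) hx (by omega)
    simpa [mul_assoc, inv_mul_eq_iff_eq_mul] using this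
  · exact short hg hk h

theorem rhoAB_injective_of_forall_eq_zero (H : ∀ a ∈ SA \ SB, ∀ b ∈ SB \ SA, M a b = 0) :
    Function.Injective (rhoAB cs SA SB) := by
  rw [injective_iff_map_eq_one]
  intro g hg
  obtain ⟨k, hk⟩ := nfSet_nonempty cs SA SB g
  exact eq_one_of_mem_nfSet cs (n := k + 2) (by omega)
    (fun a ha b hb => Or.inl (H a ha b hb)) hg hk (by omega)

theorem ofA_mul_ofB_pow_ne_one {a b : B} (ha : a ∈ SA \ SB) (hb : b ∈ SB \ SA) {k : ℕ}
    (hk : k ≠ 0) :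
    (ofA cs SA SB ⟨cs.simple a, simple_mem_sp cs ha.1⟩ *
      ofB cs SA SB ⟨cs.simple b, simple_mem_sp cs hb.1⟩) ^ k ≠ 1 := by
  let φ := phi2 (sp cs SA) (sp cs SB) (sp cs SA ⊓ sp cs SB) inf_le_left inf_le_right
  have hφ : ∀ i, Function.Injective (φ i) := by
    rintro (_ | _)
    · exact Subgroup.inclusion_injective inf_le_right
    · exact Subgroup.inclusion_injective inf_le_left
  let u : fam2 (sp cs SA) (sp cs SB) true := ⟨cs.simple a, simple_mem_sp cs ha.1⟩
  let v : fam2 (sp cs SA) (sp cs SB) false := ⟨cs.simple b, simple_mem_sp cs hb.1⟩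
  have hu : u ∉ (φ true).range := by
    rintro ⟨x, hx⟩
    have hx : (x : W) = cs.simple a := congrArg Subtype.val hx
    exact ha.2 ((simple_mem_sp_iff cs).mp (hx ▸ x.2.2))
  have hv : v ∉ (φ false).range := by
    rintro ⟨x, hx⟩
    have hx : (x : W) = cs.simple b := congrArg Subtype.val hx
    exact hb.2 ((simple_mem_sp_iff cs).mp (hx ▸ x.2.1))
  have hu1 : u ≠ 1 := fun h => hu (h ▸ one_mem _)
  have hv1 : v ≠ 1 := fun h => hv (h ▸ one_mem _)
  let ι := fun i => Monoid.CoprodI.of (M := fun i => ↥(fam2 (sp cs SA) (sp cs SB) i)) (i := i)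
  have hw : ∀ k : ℕ, ∃ w : Monoid.CoprodI.Word fun i => ↥(fam2 (sp cs SA) (sp cs SB) i),
      Monoid.PushoutI.Reduced φ w ∧ w.prod = (ι true u * ι false v) ^ k ∧
      w.fstIdx ≠ some false ∧ (k ≠ 0 → w ≠ .empty) := by
    intro k
    induction k with
    | zero =>
      exact ⟨.empty, fun g hg => absurd hg List.not_mem_nil, by simp, nofun, fun h => absurd rfl h⟩
    | succ k ih =>
      obtain ⟨w, hr, hp, hi, -⟩ := ih
      refine ⟨.cons u (.cons v w hi hv1) nofun hu1, ?_, ?_, nofun, ?_⟩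
      · intro g hg
        rcases List.mem_cons.mp hg with rfl | hg
        · exact hu
        rcases List.mem_cons.mp hg with rfl | hg
        · exact hv
        exact hr g hg
      · rw [Monoid.CoprodI.Word.prod_cons, Monoid.CoprodI.Word.prod_cons, hp, pow_succ', mul_assoc]
      · exact fun _ h => List.cons_ne_nil _ _ (congrArg Monoid.CoprodI.Word.toList h)
  obtain ⟨w, hr, hp, -, hne⟩ := hw k
  intro h
  refine hne hk (hr.eq_empty_of_mem_range hφ ⟨1, ?_⟩)
  rw [hp, map_one, map_pow, map_mul]
  exact h.symm

theorem isLeast_nfLength_ker {m : ℕ} (hm : m ≠ 0)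
    (hab : ∃ a ∈ SA \ SB, ∃ b ∈ SB \ SA, M a b = m)
    (H : ∀ a ∈ SA \ SB, ∀ b ∈ SB \ SA, M a b = 0 ∨ m ≤ M a b) :
    IsLeast {k | ∃ g, g ∈ MonoidHom.ker (rhoAB cs SA SB) ∧ g ≠ 1 ∧
      nfLength (ofA cs SA SB).range (ofB cs SA SB).range g = k} (2 * m) := by
  obtain ⟨a, ha, b, hb, rfl⟩ := hab
  have hne : M a b ≠ 1 := M.off_diagonal a b (by rintro rfl; exact ha.2 hb.1)
  have lower : ∀ g ∈ MonoidHom.ker (rhoAB cs SA SB), g ≠ 1 →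
      2 * M a b ≤ nfLength (ofA cs SA SB).range (ofB cs SA SB).range g := by
    intro g hg h1
    by_contra! hlt
    exact h1 (eq_one_of_mem_nfSet cs (by omega) H hg
      (Nat.sInf_mem (nfSet_nonempty cs SA SB g)) hlt)
  refine ⟨?_, ?_⟩
  · have hker : (ofA cs SA SB ⟨cs.simple a, simple_mem_sp cs ha.1⟩ *
        ofB cs SA SB ⟨cs.simple b, simple_mem_sp cs hb.1⟩) ^ M a b ∈
        MonoidHom.ker (rhoAB cs SA SB) := by
      rw [MonoidHom.mem_ker, map_pow, map_mul, rhoAB_ofA, rhoAB_ofB]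
      exact cs.simple_mul_simple_pow a b
    have h1 := ofA_mul_ofB_pow_ne_one cs ha hb hm
    obtain ⟨l, hl, hlen, hp⟩ := exists_altList_pow
      (P := (ofA cs SA SB).range) (Q := (ofB cs SA SB).range)
      (x := ofA cs SA SB ⟨cs.simple a, simple_mem_sp cs ha.1⟩)
      (y := ofB cs SA SB ⟨cs.simple b, simple_mem_sp cs hb.1⟩) ⟨_, rfl⟩ ⟨_, rfl⟩ (M a b)
    exact ⟨_, hker, h1, le_antisymm (Nat.sInf_le ⟨l, hlen, hp, Or.inl hl⟩) (lower _ hker h1)⟩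
  · rintro k ⟨g, hg, h1, rfl⟩
    exact lower g hg h1

end Kernel

/-- Computation of the Gersten–Stallings angle between two distinct special
subgroups `A` and `B` of `W` over `A ∩ B`:  the natural map `ρ : A *_{A ∩ B} B → W` is
injective if `A ⊆ B` or `B ⊆ A`, and otherwise, letting
`m = min { m_{a,b} : a ∈ S_A − S_B, b ∈ S_B − S_A }`, the map `ρ` is injective if `m = ∞`,
while if `m < ∞` the minimal normal form length among nontrivial elements of `ker ρ` is
exactly `2m`. -/
theorem stmt_8 {W : Type*} [Group W] [Fintype B] {M : CoxeterMatrix B}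
    (cs : CoxeterSystem M W) (SA SB : Set B) (hne : sp cs SA ≠ sp cs SB) :
    ((sp cs SA ≤ sp cs SB ∨ sp cs SB ≤ sp cs SA) →
      Function.Injective (rhoAB cs SA SB)) ∧
    (¬ (sp cs SA ≤ sp cs SB ∨ sp cs SB ≤ sp cs SA) →
      ((∀ a ∈ SA \ SB, ∀ b ∈ SB \ SA, M a b = 0) →
        Function.Injective (rhoAB cs SA SB)) ∧
      ∀ m₀ : ℕ, m₀ ≠ 0 →
        (∃ a ∈ SA \ SB, ∃ b ∈ SB \ SA, M a b = m₀) →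
        (∀ a ∈ SA \ SB, ∀ b ∈ SB \ SA, M a b = 0 ∨ m₀ ≤ M a b) →
        IsLeast {k | ∃ g, g ∈ MonoidHom.ker (rhoAB cs SA SB) ∧ g ≠ 1 ∧
          nfLength (ofA cs SA SB).range (ofB cs SA SB).range g = k} (2 * m₀)) := by
  refine ⟨fun h => h.elim (rhoAB_injective_of_le cs SA SB) (rhoAB_injective_of_ge cs SA SB),
    fun _ => ⟨rhoAB_injective_of_forall_eq_zero cs, ?_⟩⟩
  exact fun m hm hab H => isLeast_nfLength_ker cs hm hab H

end CoxFA
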